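/- Let X be an n-by-m matrix with all entries in {-1, +1} and m ≥ 2. Then E(s²) = 100·n²·(e^A_2 − 2)·(e^P_2 − 2). -/

import Mathlib

open Finset
open scoped Classical

/-- The aliasing index `ρ_{|S|}(S)` of a set `S` of columns of the design `X`. -/
noncomputable def rho {n m : ℕ} (X : Fin n → Fin m → ℝ) (S : Finset (Fin m)) : ℝ :=
  (1 / (n : ℝ)) * |∑ i : Fin n, ∏ j ∈ S, X i j|

/-- The aliasing index group `α_k`: all `k`-subsets of columns with nonzero aliasing index. -/
noncomputable def alphaGroup {n m : ℕ} (X : Fin n → Fin m → ℝ) (k : ℕ) :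
    Finset (Finset (Fin m)) :=
  (Finset.powersetCard k (Finset.univ : Finset (Fin m))).filter (fun S => rho X S ≠ 0)

/-- `max α_k`, the maximum aliasing index in `α_k` (0 if `α_k` is empty). -/
noncomputable def maxAlpha {n m : ℕ} (X : Fin n → Fin m → ℝ) (k : ℕ) : ℝ :=
  if h : (alphaGroup X k).Nonempty then (alphaGroup X k).sup' h (rho X) else 0

/-- The average of the squared aliasing indices over `α_k` (0 if `α_k` is empty). -/
noncomputable def barAlphaSq {n m : ℕ} (X : Fin n → Fin m → ℝ) (k : ℕ) : ℝ :=
  (∑ S ∈ alphaGroup X k, (rho X S) ^ 2) / ((alphaGroup X k).card : ℝ)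

/-- The `k`-th entry of the M-pattern. -/
noncomputable def eM {n m : ℕ} (X : Fin n → Fin m → ℝ) (k : ℕ) : ℝ :=
  (k : ℝ) + maxAlpha X k / 10

/-- The `k`-th entry of the A-pattern. -/
noncomputable def eA {n m : ℕ} (X : Fin n → Fin m → ℝ) (k : ℕ) : ℝ :=
  (k : ℝ) + barAlphaSq X k / 10

/-- The `k`-th entry of the P-pattern. -/
noncomputable def eP {n m : ℕ} (X : Fin n → Fin m → ℝ) (k : ℕ) : ℝ :=
  (k : ℝ) + ((alphaGroup X k).card : ℝ) / (Nat.choose m k : ℝ) / 10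

/-- The `k`-th entry of the generalized wordlength pattern: `A_k(X) = ∑_{|S|=k} ρ_k(S)²`. -/
noncomputable def gwlp {n m : ℕ} (X : Fin n → Fin m → ℝ) (k : ℕ) : ℝ :=
  ∑ S ∈ Finset.powersetCard k (Finset.univ : Finset (Fin m)), (rho X S) ^ 2

/-- The inner product `s_{ij}` between columns `i` and `j` of `X`. -/
noncomputable def sij {n m : ℕ} (X : Fin n → Fin m → ℝ) (i j : Fin m) : ℝ :=
  ∑ u : Fin n, X u i * X u j

/-- `E(s²) = ∑_{i<j} s_{ij}² / C(m,2)`. -/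
noncomputable def Es2 {n m : ℕ} (X : Fin n → Fin m → ℝ) : ℝ :=
  (∑ p ∈ (Finset.univ : Finset (Fin m × Fin m)).filter (fun p => p.1 < p.2),
    (sij X p.1 p.2) ^ 2) / (Nat.choose m 2 : ℝ)

/-- `max_{|S|=r} ρ_r(S)`, the maximum aliasing index over all `r`-subsets of columns. -/
noncomputable def maxRhoAll {n m : ℕ} (X : Fin n → Fin m → ℝ) (r : ℕ) : ℝ :=
  if h : (Finset.powersetCard r (Finset.univ : Finset (Fin m))).Nonempty then
    (Finset.powersetCard r (Finset.univ : Finset (Fin m))).sup' h (rho X) else 0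

/-- The generalized resolution `GR(X) = r + 1 − max_{|S|=r} ρ_r(S)`. -/
noncomputable def GR {n m : ℕ} (X : Fin n → Fin m → ℝ) (r : ℕ) : ℝ :=
  (r : ℝ) + 1 - maxRhoAll X r

theorem rho_pair {n m : ℕ} (X : Fin n → Fin m → ℝ) {i j : Fin m} (h : i ≠ j) :
    rho X {i, j} = (1 / (n : ℝ)) * |sij X i j| := by
  simp [rho, sij, Finset.prod_pair h]

/-- Summing over ordered pairs `i < j` amounts to summing over two-element subsets. -/
theorem sum_lt_pairs_eq_sum_powersetCard_two {ι M : Type*} [Fintype ι] [LinearOrder ι]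
    [AddCommMonoid M] (f : Finset ι → M) :
    ∑ p ∈ (Finset.univ : Finset (ι × ι)).filter (fun p => p.1 < p.2), f {p.1, p.2} =
      ∑ S ∈ Finset.powersetCard 2 (Finset.univ : Finset ι), f S := by
  refine Finset.sum_bij (fun p _ => {p.1, p.2}) ?_ ?_ ?_ (fun _ _ => rfl)
  · intro p hp
    simpa [Finset.mem_powersetCard] using Finset.card_pair (Finset.mem_filter.1 hp).2.ne
  · rintro ⟨a, b⟩ hab ⟨c, d⟩ hcd h
    have hab' : a < b := (Finset.mem_filter.1 hab).2
    have hcd' : c < d := (Finset.mem_filter.1 hcd).2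
    have ha : a ∈ ({c, d} : Finset ι) := h ▸ Finset.mem_insert_self a {b}
    have hb : b ∈ ({c, d} : Finset ι) :=
      h ▸ Finset.mem_insert_of_mem (Finset.mem_singleton_self b)
    simp only [Finset.mem_insert, Finset.mem_singleton] at ha hb
    rcases ha with rfl | rfl <;> rcases hb with rfl | rfl
    · exact absurd hab' (lt_irrefl _)
    · rfl
    · exact absurd hab' hcd'.asymm
    · exact absurd hab' (lt_irrefl _)
  · intro S hS
    obtain ⟨a, b, hab, rfl⟩ := Finset.card_eq_two.1 (Finset.mem_powersetCard.1 hS).2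
    rcases lt_or_gt_of_ne hab with h | h
    · exact ⟨(a, b), by simpa using h, rfl⟩
    · exact ⟨(b, a), by simpa using h, Finset.pair_comm b a⟩

theorem sum_alphaGroup_rho_sq {n m : ℕ} (X : Fin n → Fin m → ℝ) (k : ℕ) :
    ∑ S ∈ alphaGroup X k, rho X S ^ 2 = gwlp X k := by
  refine Finset.sum_subset (Finset.filter_subset _ _) fun S hS hS' => ?_
  have : rho X S = 0 := by
    by_contra h
    exact hS' (Finset.mem_filter.2 ⟨hS, h⟩)
  simp [this]

theorem barAlphaSq_mul_card {n m : ℕ} (X : Fin n → Fin m → ℝ) (k : ℕ) :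
    barAlphaSq X k * ((alphaGroup X k).card : ℝ) = gwlp X k := by
  rw [← sum_alphaGroup_rho_sq, barAlphaSq]
  refine div_mul_cancel_of_imp fun h => ?_
  rw [Finset.card_eq_zero.1 (Nat.cast_eq_zero.1 h), Finset.sum_empty]

theorem sum_sij_sq {n m : ℕ} (X : Fin n → Fin m → ℝ) :
    ∑ p ∈ (Finset.univ : Finset (Fin m × Fin m)).filter (fun p => p.1 < p.2),
      sij X p.1 p.2 ^ 2 = (n : ℝ) ^ 2 * gwlp X 2 := by
  rw [gwlp, ← sum_lt_pairs_eq_sum_powersetCard_two fun S => rho X S ^ 2, Finset.mul_sum]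
  refine Finset.sum_congr (by congr) fun p hp => ?_
  rw [rho_pair X (Finset.mem_filter.1 hp).2.ne, mul_pow, sq_abs]
  rcases n.eq_zero_or_pos with rfl | hn
  · simp [sij]
  · field_simp

/-- Theorem 3 of the paper.
`E(s²) = 100·n²·(e^A_2 − 2)·(e^P_2 − 2)`. -/
theorem es2_eq_of_eA_eP {n m : ℕ} (X : Fin n → Fin m → ℝ)
    (hX : ∀ i j, X i j = 1 ∨ X i j = -1) (hm : 2 ≤ m) :
    Es2 X = 100 * (n : ℝ) ^ 2 * (eA X 2 - 2) * (eP X 2 - 2) := by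
  simp only [Es2, eA, eP, sum_sij_sq, ← barAlphaSq_mul_card]
  push_cast
  ring
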